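/- arXiv:2001.04311 — 10 statements merged into one kernel-verified Lean document; each statement's English description precedes it below -/
import Mathlib

section
/- Let O, M, B be three points in the Euclidean plane ℝ² such that M ≠ O, M ≠ B, the angle at M is a right angle (i.e., the vectors O − M and B − M are orthogonal), and the angle ∠BOM is at most π/4. Then for every point K on the closed segment [M, B] and every point L on the closed segment [O, B], dist(O, K) + dist(K, L) ≥ dist(O, B). -/
open Real EuclideanGeometry
open scoped RealInnerProductSpace

/-- In coordinates with `O = 0`, `M = (m, 0)`, `B = (m, b)`, `K = (m, t * b)`,
`L = (s * m, s * b)`, the numbers `d`, `x`, `y` are the distances `OB`, `OK`, `KL`. -/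
lemma le_add_of_sq_eq {m b d x y s t : ℝ} (hb : 0 ≤ b) (hbm : b ≤ m)
    (hd : 0 < d) (hx : 0 ≤ x) (hy : 0 ≤ y) (ht : t ≤ 1)
    (hd2 : d ^ 2 = m ^ 2 + b ^ 2) (hx2 : x ^ 2 = m ^ 2 + t ^ 2 * b ^ 2)
    (hy2 : y ^ 2 = (1 - s) ^ 2 * m ^ 2 + (t - s) ^ 2 * b ^ 2) :
    d ≤ x + y := by
  have hKL : m * b * (1 - t) ≤ d * y := by
    refine le_of_sq_le_sq ?_ (by positivity)
    rw [mul_pow d, hd2, hy2]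
    nlinarith [sq_nonneg ((1 - s) * m ^ 2 + (t - s) * b ^ 2)]
  have hOK : d ^ 2 - m * b * (1 - t) ≤ d * x := by
    refine le_of_sq_le_sq ?_ (by positivity)
    have hfac : (d * x) ^ 2 - (d ^ 2 - m * b * (1 - t)) ^ 2 =
        b * (1 - t) * (2 * ((m - b) * (m ^ 2 + b ^ 2)) + b ^ 3 * (1 - t)) := by
      rw [mul_pow d, hx2, hd2]
      ring
    have h1 : 0 ≤ 1 - t := sub_nonneg.2 ht
    have h2 : 0 ≤ m - b := sub_nonneg.2 hbm
    have : 0 ≤ b * (1 - t) * (2 * ((m - b) * (m ^ 2 + b ^ 2)) + b ^ 3 * (1 - t)) := by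
      positivity
    linarith
  refine le_of_mul_le_mul_left ?_ hd
  linarith

lemma norm_smul_add_smul_sq_of_inner_eq_zero {V : Type*} [NormedAddCommGroup V]
    [InnerProductSpace ℝ V] {u v : V} (h : ⟪u, v⟫ = 0) (p q : ℝ) :
    ‖p • u + q • v‖ ^ 2 = p ^ 2 * ‖u‖ ^ 2 + q ^ 2 * ‖v‖ ^ 2 := by
  rw [norm_add_sq_real, real_inner_smul_left, real_inner_smul_right, h, norm_smul, norm_smul,
    mul_pow, mul_pow, Real.norm_eq_abs, Real.norm_eq_abs, sq_abs, sq_abs]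
  ring

lemma norm_le_norm_of_angle_add_le_pi_div_four {V : Type*} [NormedAddCommGroup V]
    [InnerProductSpace ℝ V] {u v : V} (hu : u ≠ 0) (h : ⟪u, v⟫ = 0)
    (hangle : InnerProductGeometry.angle (u + v) u ≤ π / 4) : ‖v‖ ≤ ‖u‖ := by
  have hu' : 0 < ‖u‖ := norm_pos_iff.2 hu
  have hcos : √2 / 2 ≤ Real.cos (InnerProductGeometry.angle (u + v) u) := by
    rw [← Real.cos_pi_div_four]
    exact Real.cos_le_cos_of_nonneg_of_le_pi (InnerProductGeometry.angle_nonneg _ _)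
      (by linarith [Real.pi_pos]) hangle
  have hmul := InnerProductGeometry.cos_angle_mul_norm_mul_norm (u + v) u
  rw [inner_add_left, real_inner_comm, real_inner_comm u v, h, add_zero,
    real_inner_self_eq_norm_sq] at hmul
  have hle : √2 / 2 * ‖u + v‖ ≤ ‖u‖ := by
    refine le_of_mul_le_mul_right ?_ hu'
    calc √2 / 2 * ‖u + v‖ * ‖u‖
        = √2 / 2 * (‖u + v‖ * ‖u‖) := by ring
      _ ≤ Real.cos (InnerProductGeometry.angle (u + v) u) * (‖u + v‖ * ‖u‖) := by gcongr
      _ = ‖u‖ * ‖u‖ := by rw [hmul, sq]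
  have hsq : (√2 / 2 * ‖u + v‖) ^ 2 ≤ ‖u‖ ^ 2 := by gcongr
  have hnorm := norm_smul_add_smul_sq_of_inner_eq_zero h 1 1
  rw [one_smul, one_smul] at hnorm
  rw [mul_pow, div_pow, Real.sq_sqrt zero_le_two, hnorm] at hsq
  refine le_of_sq_le_sq ?_ hu'.le
  linarith

theorem segment_detour_ge (O M B : EuclideanSpace ℝ (Fin 2))
    (hMO : M ≠ O) (hMB : M ≠ B)
    (hright : ⟪O - M, B - M⟫ = 0)
    (hangle : ∠ B O M ≤ π / 4)
    (K L : EuclideanSpace ℝ (Fin 2))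
    (hK : K ∈ segment ℝ M B) (hL : L ∈ segment ℝ O B) :
    dist O K + dist K L ≥ dist O B := by
  rw [segment_eq_image'] at hK hL
  obtain ⟨t, ht, rfl⟩ := hK
  obtain ⟨s, -, rfl⟩ := hL
  have hu : M - O ≠ 0 := sub_ne_zero.2 hMO
  have horth : ⟪M - O, B - M⟫ = 0 := by
    rw [← neg_sub O M, inner_neg_left, hright, neg_zero]
  have hle : ‖B - M‖ ≤ ‖M - O‖ := by
    refine norm_le_norm_of_angle_add_le_pi_div_four hu horth ?_
    rwa [add_comm, sub_add_sub_cancel]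
  have hOB : dist O B ^ 2 = ‖M - O‖ ^ 2 + ‖B - M‖ ^ 2 := by
    have h := norm_smul_add_smul_sq_of_inner_eq_zero horth 1 1
    rw [dist_comm, dist_eq_norm,
      show B - O = (1 : ℝ) • (M - O) + (1 : ℝ) • (B - M) by module, h]
    ring
  have hpos : 0 < dist O B := by
    have := norm_pos_iff.2 hu
    refine dist_nonneg.lt_of_ne' (sq_pos_iff.1 ?_)
    rw [hOB]
    positivity
  refine le_add_of_sq_eq (s := s) (norm_nonneg _) hle hpos dist_nonneg
    dist_nonneg ht.2 hOB ?_ ?_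
  · rw [dist_comm, dist_eq_norm,
      show M + t • (B - M) - O = (1 : ℝ) • (M - O) + t • (B - M) by module,
      norm_smul_add_smul_sq_of_inner_eq_zero horth]
    ring
  · rw [dist_eq_norm,
      show M + t • (B - M) - (O + s • (B - O)) = (1 - s) • (M - O) + (t - s) • (B - M) by module,
      norm_smul_add_smul_sq_of_inner_eq_zero horth]
end

section
/- Let O, M, B be three points in the Euclidean plane ℝ² such that M ≠ O, M ≠ B, the vectors O − M and B − M are orthogonal, and the angle ∠BOM is at most π/4. If K is a point on the closed segment [M, B], L is a point on the closed segment [O, B], and dist(O, K) + dist(K, L) = dist(O, B), then K = B and L = B. -/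
open Real EuclideanGeometry
open scoped RealInnerProductSpace

/-- In a right triangle with legs `b ≤ a` and hypotenuse `c`, a broken line of lengths `x`, `y`
from the vertex between `a` and `c`, via the point of the leg `b` at parameter `s`, to the point
of the hypotenuse at parameter `t`, can have length `c` only if `s = 1`. -/
lemma detour_parameter_eq_one {a b c x y s t : ℝ} (hb : 0 < b) (hba : b ≤ a)
    (hc : 0 < c) (hx : 0 ≤ x) (hy : 0 ≤ y) (hs : s ≤ 1)
    (hc2 : c ^ 2 = a ^ 2 + b ^ 2) (hx2 : x ^ 2 = a ^ 2 + s ^ 2 * b ^ 2)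
    (hy2 : y ^ 2 = (s - t) ^ 2 * b ^ 2 + (1 - t) ^ 2 * a ^ 2) (h : x + y = c) : s = 1 := by
  by_contra hne
  have hp : 0 < 1 - s := sub_pos.2 (lt_of_le_of_ne hs hne)
  have hcy : a * b * (1 - s) ≤ c * y := by
    refine abs_le_of_sq_le_sq' ?_ (by positivity) |>.2
    have : (c * y) ^ 2 =
        (a * b * (1 - s)) ^ 2 + ((s - t) * b ^ 2 + (1 - t) * a ^ 2) ^ 2 := by
      rw [mul_pow, hc2, hy2]; ring
    rw [this]
    exact le_add_of_nonneg_right (sq_nonneg _)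
  have hcx : c * x ≤ c ^ 2 - a * b * (1 - s) := by
    have : c * x = c ^ 2 - c * y := by rw [← h]; ring
    linarith
  have hsq : (c * x) ^ 2 ≤ (c ^ 2 - a * b * (1 - s)) ^ 2 :=
    pow_le_pow_left₀ (by positivity) hcx 2
  have hle : (b * (1 - s)) * (c ^ 2 * (2 * a - b * (1 + s))) ≤
      (b * (1 - s)) * (a ^ 2 * (b * (1 - s))) := by
    have e : (c * x) ^ 2 = c ^ 2 * (c ^ 2 - b ^ 2 + s ^ 2 * b ^ 2) := by
      rw [mul_pow, hx2, hc2]; ring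
    rw [e] at hsq
    linarith
  have hle' := le_of_mul_le_mul_left hle (by positivity)
  have h1 : c ^ 2 * (b * (1 - s)) ≤ c ^ 2 * (2 * a - b * (1 + s)) :=
    mul_le_mul_of_nonneg_left (by linarith) (by positivity)
  have h2 : 0 < b ^ 2 * (b * (1 - s)) := by positivity
  rw [hc2] at h1 hle'
  linarith

/-- In a right triangle, if the angle at a vertex is at most `π / 4`, the leg opposite to it is
at most the adjacent leg. -/
lemma norm_le_norm_of_angle_le_pi_div_four {V : Type*} [NormedAddCommGroup V]
    [InnerProductSpace ℝ V] {u v : V} (huv : ⟪u, v⟫ = 0) (hu : u ≠ 0)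
    (h : InnerProductGeometry.angle (u + v) u ≤ π / 4) : ‖v‖ ≤ ‖u‖ := by
  rw [InnerProductGeometry.angle_comm,
    InnerProductGeometry.angle_add_eq_arctan_of_inner_eq_zero huv hu, ← Real.arctan_one,
    Real.arctan_le_arctan_iff, div_le_one (norm_pos_iff.2 hu)] at h
  exact h

theorem segment_detour_eq_iff_endpoint (O M B : EuclideanSpace ℝ (Fin 2))
    (hMO : M ≠ O) (hMB : M ≠ B)
    (hright : ⟪O - M, B - M⟫ = 0)
    (hangle : ∠ B O M ≤ π / 4)
    (K L : EuclideanSpace ℝ (Fin 2))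
    (hK : K ∈ segment ℝ M B) (hL : L ∈ segment ℝ O B)
    (heq : dist O K + dist K L = dist O B) :
    K = B ∧ L = B := by
  have norm_sq (p q : ℝ) : ‖p • (O - M) + q • (B - M)‖ ^ 2 =
      p ^ 2 * ‖O - M‖ ^ 2 + q ^ 2 * ‖B - M‖ ^ 2 := by
    rw [norm_add_sq_real, inner_smul_left, inner_smul_right, hright, norm_smul, norm_smul,
      mul_pow, mul_pow, Real.norm_eq_abs, Real.norm_eq_abs, sq_abs, sq_abs]
    simp
  have hle : ‖B - M‖ ≤ ‖O - M‖ := by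
    rw [norm_sub_rev O M]
    refine norm_le_norm_of_angle_le_pi_div_four ?_ (sub_ne_zero.2 hMO) ?_
    · rw [← neg_sub O M, inner_neg_left, hright, neg_zero]
    · rwa [sub_add_sub_cancel']
  have hOB : O ≠ B := by
    rintro rfl
    exact hMO (sub_eq_zero.1 (inner_self_eq_zero.1 hright)).symm
  rw [segment_eq_image_lineMap] at hK hL
  obtain ⟨s, ⟨-, hs⟩, rfl⟩ := hK
  obtain ⟨t, -, rfl⟩ := hL
  have hs1 : s = 1 := by
    refine detour_parameter_eq_one (t := t)
      (norm_pos_iff.2 (sub_ne_zero.2 hMB.symm)) hle (dist_pos.2 hOB) dist_nonneg dist_nonneg hs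
      ?_ ?_ ?_ heq
    · have e : O - B = (1 : ℝ) • (O - M) + (-1 : ℝ) • (B - M) := by module
      rw [dist_eq_norm, e, norm_sq]; ring
    · have e : O - AffineMap.lineMap M B s = (1 : ℝ) • (O - M) + (-s) • (B - M) := by
        rw [AffineMap.lineMap_apply_module]; module
      rw [dist_eq_norm, e, norm_sq]; ring
    · have e : AffineMap.lineMap M B s - AffineMap.lineMap O B t =
          (t - 1) • (O - M) + (s - t) • (B - M) := by
        rw [AffineMap.lineMap_apply_module, AffineMap.lineMap_apply_module]; module
      rw [dist_eq_norm, e, norm_sq]; ring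
  subst hs1
  rw [AffineMap.lineMap_apply_one] at heq ⊢
  exact ⟨rfl, (dist_eq_zero.1 (by linarith)).symm⟩
end

section
/- Fix d > 0, ε > 0 and 0 < φ ≤ π/4. Let C = {p ∈ ℝ² : p₁ ≥ ‖p‖·cos φ} be the closed cone with apex at the origin, axis the positive x-axis, and half-angle φ, and let ℓ = {p ∈ ℝ² : p₁ = (d + ε)·cos φ} be the line through the two points A = ((d+ε)cos φ, (d+ε)sin φ) and B = ((d+ε)cos φ, −(d+ε)sin φ) lying on the two extreme rays of C at distance d + ε from the origin. If γ : ℝ → ℝ² is a 1-Lipschitz function with γ(0) = 0 and γ(d) ∉ C, then for every t ∈ [0, d] one has (γ(t))₁ ≠ (d + ε)·cos φ, i.e., the trajectory γ does not intersect the line ℓ during the time interval [0, d]. -/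
open Real

/-- With `k = cos φ`, a point of the plane outside the cone and on the near side of the line
`x = R * k` is at distance at least `R` from the reflection `(2 * R * k, 0)` of the apex in
that line. -/
theorem sq_le_sq_dist_reflected_apex {R k x y : ℝ} (hR : 0 < R) (hk : 0 < k)
    (hk2 : 1 / 2 ≤ k ^ 2) (hx : x ≤ R * k) (hxy : x < √(x ^ 2 + y ^ 2) * k) :
    R ^ 2 ≤ (x - 2 * R * k) ^ 2 + y ^ 2 := by
  rcases le_or_gt x 0 with h | h
  · nlinarith [mul_nonneg (mul_nonneg hR.le hk.le) (neg_nonneg.2 h), sq_nonneg y, sq_nonneg x,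
      mul_le_mul_of_nonneg_left hk2 (sq_nonneg R)]
  · obtain ⟨w, rfl⟩ : ∃ w, x = w * k := ⟨x / k, by field_simp⟩
    have hw : 0 < w := pos_of_mul_pos_left h hk.le
    have hwR : w ≤ R := le_of_mul_le_mul_right hx hk
    have hwn : w ^ 2 < (w * k) ^ 2 + y ^ 2 :=
      (Real.lt_sqrt hw.le).1 (lt_of_mul_lt_mul_right hxy hk.le)
    have h4 : 0 ≤ 4 * R * k ^ 2 - w - R := by
      nlinarith [mul_le_mul_of_nonneg_left hk2 hR.le]
    nlinarith [mul_nonneg (sub_nonneg.2 hwR) h4]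

theorem no_line_hit_if_outside_cone
    (d ε φ : ℝ) (hd : 0 < d) (hε : 0 < ε) (hφ : 0 < φ) (hφ' : φ ≤ π / 4)
    (γ : ℝ → EuclideanSpace ℝ (Fin 2))
    (hlip : LipschitzWith 1 γ) (h0 : γ 0 = 0)
    (hout : ¬ (γ d) 0 ≥ ‖γ d‖ * Real.cos φ) :
    ∀ t ∈ Set.Icc (0 : ℝ) d, (γ t) 0 ≠ (d + ε) * Real.cos φ := by
  rintro t ⟨ht0, htd⟩ hline
  have hcos : √2 / 2 ≤ cos φ := by
    rw [← cos_pi_div_four]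
    exact cos_le_cos_of_nonneg_of_le_pi hφ.le (by linarith [pi_pos]) hφ'
  have hk : 0 < cos φ := lt_of_lt_of_le (by positivity) hcos
  have hk2 : 1 / 2 ≤ cos φ ^ 2 := by
    have h := pow_le_pow_left₀ (by positivity) hcos 2
    rw [div_pow, sq_sqrt (by norm_num)] at h
    linarith
  have hdist (a b : ℝ) (hab : a ≤ b) : ‖γ b - γ a‖ ≤ b - a := by
    have h := hlip.dist_le_mul b a
    rwa [dist_eq_norm, Real.dist_eq, abs_of_nonneg (sub_nonneg.2 hab), NNReal.coe_one,
      one_mul] at h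
  have hnorm (a : ℝ) (ha : 0 ≤ a) : ‖γ a‖ ≤ a := by
    simpa [h0] using hdist 0 a ha
  rw [ge_iff_le, not_le] at hout
  have hx : (γ d) 0 ≤ (d + ε) * cos φ := by
    have h := mul_le_mul_of_nonneg_right (hnorm d hd.le) hk.le
    nlinarith [mul_pos hε hk]
  let o : EuclideanSpace ℝ (Fin 2) := !₂[2 * (d + ε) * cos φ, 0]
  have hreflect : ‖γ t - o‖ = ‖γ t‖ := by
    rw [EuclideanSpace.norm_eq, EuclideanSpace.norm_eq]
    congr 1
    simp [Fin.sum_univ_two, o, hline]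
    ring
  have hle : ‖γ d - o‖ ≤ d := by
    have h := norm_sub_le_norm_sub_add_norm_sub (γ d) (γ t) o
    linarith [hdist t d htd, hnorm t ht0]
  have hsq : ‖γ d - o‖ ^ 2 = ((γ d) 0 - 2 * (d + ε) * cos φ) ^ 2 + (γ d) 1 ^ 2 := by
    simp [EuclideanSpace.norm_sq_eq, Fin.sum_univ_two, o]
  have hn : ‖γ d‖ = √((γ d) 0 ^ 2 + (γ d) 1 ^ 2) := by
    simp [EuclideanSpace.norm_eq, Fin.sum_univ_two]
  rw [hn] at hout
  have hfar := sq_le_sq_dist_reflected_apex (by linarith) hk hk2 hx hout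
  rw [← hsq] at hfar
  linarith [le_of_abs_le (abs_le_of_sq_le_sq hfar (norm_nonneg _))]
end

section
/- Let n ≥ 1, let γ₁, …, γₙ : ℝ → ℝ² be 1-Lipschitz functions with γᵢ(0) = 0 for all i, let d > 0, let 0 < φ ≤ π/4, and let u ∈ ℝ² be a unit vector. Suppose that at time d no robot lies in the closed cone with apex at the origin, axis u, and half-angle φ, except possibly robots located at the origin; that is, for each i, either γᵢ(d) = 0 or ⟪u, γᵢ(d)⟫ < ‖γᵢ(d)‖·cos φ. Then for every c with 0 ≤ c < 1/cos φ there exists ρ > 0 such that for all i and all t ∈ [0, c·ρ], ⟪u, γᵢ(t)⟫ ≠ ρ. In other words, there is a line perpendicular to u at distance ρ from the origin that no robot has hit by time c·ρ, so the search competitive ratio of the trajectories is at least 1/cos φ. -/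
open Real
open scoped RealInnerProductSpace

/-- If `q` lies on the line `⟪u, ·⟫ = ρ`, then reflecting `p` across that line does not change its
distance to `q`, so the path from the origin to `p` through `q` is at least as long as the segment
from the origin to the reflection of `p`. -/
lemma norm_sq_add_le_of_inner_eq {E : Type*} [NormedAddCommGroup E] [InnerProductSpace ℝ E]
    {u p q : E} (hu : ‖u‖ = 1) {ρ : ℝ} (hq : ⟪u, q⟫ = ρ) :
    ‖p‖ ^ 2 + 4 * ρ * (ρ - ⟪u, p⟫) ≤ (‖q‖ + ‖p - q‖) ^ 2 := by
  have norm_sq_add_smul (x : E) (s : ℝ) :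
      ‖x + s • u‖ ^ 2 = ‖x‖ ^ 2 + 2 * s * ⟪u, x⟫ + s ^ 2 := by
    rw [norm_add_sq_real, inner_smul_right, real_inner_comm, norm_smul, hu, mul_one,
      Real.norm_eq_abs, sq_abs]
    ring
  set s := 2 * (ρ - ⟪u, p⟫) with hs
  have hdist : ‖p - q + s • u‖ = ‖p - q‖ := by
    rw [← sq_eq_sq₀ (norm_nonneg _) (norm_nonneg _), norm_sq_add_smul, inner_sub_right, hq, hs]
    ring
  have htri : ‖p + s • u‖ ≤ ‖q‖ + ‖p - q‖ := by
    calc ‖p + s • u‖ = ‖q + (p - q + s • u)‖ := by congr 1; abel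
      _ ≤ ‖q‖ + ‖p - q + s • u‖ := norm_add_le _ _
      _ = ‖q‖ + ‖p - q‖ := by rw [hdist]
  calc ‖p‖ ^ 2 + 4 * ρ * (ρ - ⟪u, p⟫) = ‖p + s • u‖ ^ 2 := by rw [norm_sq_add_smul, hs]; ring
    _ ≤ (‖q‖ + ‖p - q‖) ^ 2 := by gcongr

/-- A 1-Lipschitz trajectory from the origin which at time `d` is outside the open cone of axis `u`
and half-angle `arccos k ≤ π / 4` has not met the line `⟪u, ·⟫ = ρ` by time `d` if `d * k < ρ`. -/
lemma inner_ne_of_inner_le_norm_mul {E : Type*} [NormedAddCommGroup E] [InnerProductSpace ℝ E]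
    {γ : ℝ → E} (hlip : LipschitzWith 1 γ) (h0 : γ 0 = 0) {u : E} (hu : ‖u‖ = 1)
    {d k ρ : ℝ} (hd : 0 < d) (hk : 0 < k) (hk2 : 1 / 2 ≤ k ^ 2)
    (hcone : ⟪u, γ d⟫ ≤ ‖γ d‖ * k) (hρ : d * k < ρ) {t : ℝ} (ht : t ∈ Set.Icc 0 d) :
    ⟪u, γ t⟫ ≠ ρ := by
  intro hq
  have hρ0 : 0 < ρ := (mul_pos hd hk).trans hρ
  have hspeed {s r : ℝ} (hsr : s ≤ r) : ‖γ r - γ s‖ ≤ r - s := by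
    have h := hlip.dist_le_mul r s
    rwa [NNReal.coe_one, one_mul, dist_eq_norm, Real.dist_eq, abs_of_nonneg (sub_nonneg.2 hsr)] at h
  have hnorm {s : ℝ} (hs : 0 ≤ s) : ‖γ s‖ ≤ s := by simpa [h0] using hspeed hs
  have hlen : ‖γ t‖ + ‖γ d - γ t‖ ≤ d := by linarith [hnorm ht.1, hspeed ht.2]
  have hpath : ‖γ d‖ ^ 2 + 4 * ρ * (ρ - ⟪u, γ d⟫) ≤ d ^ 2 :=
    (norm_sq_add_le_of_inner_eq hu hq).trans (by gcongr)
  have hinner : ρ * ⟪u, γ d⟫ ≤ ρ * (‖γ d‖ * k) := by gcongr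
  have hρk : d * k * k ≤ ρ * k := by gcongr
  have hdk : d * (1 / 2) ≤ d * k ^ 2 := by gcongr
  have hprod : 0 ≤ (d - ‖γ d‖) * (4 * (ρ * k) - ‖γ d‖ - d) :=
    mul_nonneg (by linarith [hnorm hd.le]) (by linarith [hnorm hd.le])
  linarith [mul_pos hρ0 (sub_pos.2 hρ)]

theorem cr_lower_bound_of_empty_cone
    (n : ℕ) (hn : 1 ≤ n)
    (γ : Fin n → ℝ → EuclideanSpace ℝ (Fin 2))
    (hlip : ∀ i, LipschitzWith 1 (γ i)) (h0 : ∀ i, γ i 0 = 0)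
    (d : ℝ) (hd : 0 < d)
    (φ : ℝ) (hφ : 0 < φ) (hφ' : φ ≤ π / 4)
    (u : EuclideanSpace ℝ (Fin 2)) (hu : ‖u‖ = 1)
    (hcone : ∀ i, γ i d = 0 ∨ ⟪u, γ i d⟫ < ‖γ i d‖ * Real.cos φ) :
    ∀ c : ℝ, 0 ≤ c → c < 1 / Real.cos φ →
      ∃ ρ : ℝ, 0 < ρ ∧ ∀ i, ∀ t ∈ Set.Icc (0 : ℝ) (c * ρ), ⟪u, γ i t⟫ ≠ ρ := by
  intro c hc hcφ
  have hcos : 0 < Real.cos φ := cos_pos_of_mem_Ioo ⟨by linarith [pi_pos], by linarith [pi_pos]⟩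
  have hcos2 : 1 / 2 ≤ Real.cos φ ^ 2 := by
    have h : 0 ≤ Real.cos (2 * φ) :=
      cos_nonneg_of_neg_pi_div_two_le_of_le (by linarith [pi_pos]) (by linarith)
    rw [cos_two_mul] at h
    linarith
  rcases hc.eq_or_lt with rfl | hc
  · refine ⟨1, one_pos, fun i t ht => ?_⟩
    obtain rfl : t = 0 := le_antisymm (by simpa using ht.2) ht.1
    simp [h0]
  · refine ⟨d / c, div_pos hd hc, fun i t ht => ?_⟩
    rw [mul_div_cancel₀ _ hc.ne'] at ht
    refine inner_ne_of_inner_le_norm_mul (hlip i) (h0 i) hu hd hcos hcos2 ?_ ?_ ht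
    · rcases hcone i with h | h
      · simp [h]
      · exact h.le
    · rw [lt_div_iff₀ hc, mul_assoc, mul_comm (Real.cos φ)]
      exact mul_lt_of_lt_one_right hd ((lt_div_iff₀ hcos).1 hcφ)
end

section
/- Let n ≥ 1, let 0 < γ < π/n, and let p₁, …, pₙ be points of ℝ², not all equal to the origin. Then there exists a unit vector u ∈ ℝ² such that the closed cone with apex at the origin, axis u, and half-angle π/n − γ contains none of the nonzero points pᵢ; that is, for every i with pᵢ ≠ 0 one has ⟪u, pᵢ⟫ < ‖pᵢ‖·cos(π/n − γ). -/
open Real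
open scoped RealInnerProductSpace

theorem exists_polar_angle (p : EuclideanSpace ℝ (Fin 2)) :
    ∃ θ : ℝ, p 0 = ‖p‖ * cos θ ∧ p 1 = ‖p‖ * sin θ := by
  have h : ‖(⟨p 0, p 1⟩ : ℂ)‖ = ‖p‖ := by
    rw [Complex.norm_eq_sqrt_sq_add_sq, EuclideanSpace.norm_eq]
    simp [Fin.sum_univ_two]
  refine ⟨Complex.arg ⟨p 0, p 1⟩, ?_, ?_⟩
  · rw [← h, Complex.norm_mul_cos_arg]
  · rw [← h, Complex.norm_mul_sin_arg]

theorem exists_int_abs_sub_le_of_cos_le_cos {α x : ℝ} (h0 : 0 ≤ α) (h : cos α ≤ cos x) :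
    ∃ m : ℤ, |x - m * (2 * π)| ≤ α := by
  refine ⟨round (x / (2 * π)), ?_⟩
  set m := round (x / (2 * π))
  have hle : |x - m * (2 * π)| ≤ π := by
    have hm : x - m * (2 * π) = (x / (2 * π) - m) * (2 * π) := by
      field_simp
    rw [hm, abs_mul, abs_of_pos two_pi_pos]
    nlinarith [abs_sub_round (x / (2 * π)), pi_pos]
  by_contra! hlt
  have := cos_lt_cos_of_nonneg_of_le_pi h0 hle hlt
  rw [cos_abs, cos_sub_int_mul_two_pi] at this
  linarith

/-- Cutting the circle into `n` open arcs of length `2π / n`, starting at one of `n` given angles,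
leaves an arc that contains none of these angles; its midpoint is `φ`. -/
theorem exists_angle_forall_cos_sub_lt {n : ℕ} (i₀ : Fin n) (θ : Fin n → ℝ) {α : ℝ}
    (h0 : 0 ≤ α) (hα : α < π / n) : ∃ φ : ℝ, ∀ i, cos (θ i - φ) < cos α := by
  have hn : 0 < n := i₀.pos
  have hn' : (0 : ℝ) < n := by exact_mod_cast hn
  let q : Fin n → ℤ := fun i => ⌊(θ i - θ i₀) * n / (2 * π)⌋
  obtain ⟨k, hk⟩ : ∃ k : Fin n, ∀ i, i ≠ i₀ → q i % n ≠ k := by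
    by_contra! h
    choose g hg hgk using h
    have hinj : Function.Injective g := fun a b hab => by
      have := (hgk a).symm.trans (hab ▸ hgk b)
      exact Fin.ext (by exact_mod_cast this)
    obtain ⟨a, ha⟩ := (Finite.injective_iff_surjective.mp hinj) i₀
    exact hg a ha
  refine ⟨θ i₀ + (2 * k + 1) * (π / n), fun i => ?_⟩
  by_contra! h
  obtain ⟨m, hm⟩ := exists_int_abs_sub_le_of_cos_le_cos h0 h
  obtain ⟨h1, h2⟩ := abs_lt.mp (hm.trans_lt hα)
  have hx : (θ i - θ i₀) * n / (2 * π) = k + n * m + 1 / 2 +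
      (θ i - (θ i₀ + (2 * k + 1) * (π / n)) - m * (2 * π)) * (n / (2 * π)) := by
    field_simp
    ring
  have hc : π / n * (n / (2 * π)) = 1 / 2 := by
    field_simp
  have hpos : 0 < n / (2 * π) := by positivity
  have hlo := mul_lt_mul_of_pos_right h1 hpos
  have hhi := mul_lt_mul_of_pos_right h2 hpos
  rw [neg_mul, hc] at hlo
  rw [hc] at hhi
  by_cases hi : i = i₀
  · subst hi
    rw [sub_self, zero_mul, zero_div] at hx
    have ha : ((k + n * m : ℤ) : ℝ) < 0 := by push_cast; linarith
    have hb : (0 : ℝ) < ((k + n * m + 1 : ℤ) : ℝ) := by push_cast; linarith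
    have ha' : (k + n * m : ℤ) < 0 := by exact_mod_cast ha
    have hb' : (0 : ℤ) < k + n * m + 1 := by exact_mod_cast hb
    omega
  · have hq : q i = k + n * m := by
      refine Int.floor_eq_iff.mpr ⟨?_, ?_⟩ <;> push_cast <;> linarith
    apply hk i hi
    rw [hq, Int.add_mul_emod_self_left]
    exact Int.emod_eq_of_lt (by positivity) (by exact_mod_cast k.isLt)

theorem exists_cone_avoiding_points
    (n : ℕ) (hn : 1 ≤ n)
    (γ : ℝ) (hγ : 0 < γ) (hγ' : γ < π / n)
    (p : Fin n → EuclideanSpace ℝ (Fin 2))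
    (hp : ¬ ∀ i, p i = 0) :
    ∃ u : EuclideanSpace ℝ (Fin 2), ‖u‖ = 1 ∧
      ∀ i, p i ≠ 0 → ⟪u, p i⟫ < ‖p i‖ * Real.cos (π / n - γ) := by
  choose θ hcos hsin using fun i => exists_polar_angle (p i)
  obtain ⟨φ, hφ⟩ := exists_angle_forall_cos_sub_lt ⟨0, hn⟩ θ
    (sub_nonneg.mpr hγ'.le) (sub_lt_self _ hγ)
  refine ⟨!₂[cos φ, sin φ], ?_, fun i hi => ?_⟩
  · simp [EuclideanSpace.norm_eq, Fin.sum_univ_two]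
  · have hinner : ⟪!₂[cos φ, sin φ], p i⟫ = ‖p i‖ * cos (θ i - φ) := by
      simp only [PiLp.inner_apply, Fin.sum_univ_two, RCLike.inner_apply, conj_trivial]
      rw [hcos, hsin, cos_sub]
      simp
      ring
    rw [hinner]
    exact mul_lt_mul_of_pos_left (hφ i) (norm_pos_iff.mpr hi)
end

section
/- Let n ≥ 4 and let γ₁, …, γₙ : ℝ → ℝ² be 1-Lipschitz functions with γᵢ(0) = 0 for all i (n unit-speed robots searching the plane for a shoreline). Then for every c with 0 ≤ c < 1/cos(π/n) there exist a unit vector u ∈ ℝ² and ρ > 0 such that for every i and every t ∈ [0, c·ρ], ⟪u, γᵢ(t)⟫ ≠ ρ. That is, some line at positive distance ρ from the origin is not hit by any robot within time c·ρ; hence the best possible search competitive ratio 𝒮ₙ for shoreline search with n ≥ 4 robots satisfies 𝒮ₙ ≥ 1/cos(π/n). -/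
open Real
open scoped RealInnerProductSpace

/-- The unit vector in the plane at angle `α`. -/
noncomputable def dirVec (α : ℝ) : EuclideanSpace ℝ (Fin 2) := !₂[Real.cos α, Real.sin α]

lemma norm_dirVec (α : ℝ) : ‖dirVec α‖ = 1 := by
  simp [dirVec, EuclideanSpace.norm_eq]

lemma continuous_dirVec : Continuous dirVec := by
  unfold dirVec
  fun_prop

lemma norm_dirVec_add (α β : ℝ) :
    ‖dirVec α + dirVec β‖ = 2 * |Real.cos ((α - β) / 2)| := by
  have h : (cos α + cos β) ^ 2 + (sin α + sin β) ^ 2 = (2 * cos ((α - β) / 2)) ^ 2 := by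
    rw [Real.cos_add_cos, Real.sin_add_sin]
    linear_combination 4 * cos ((α - β) / 2) ^ 2 * Real.sin_sq_add_cos_sq ((α + β) / 2)
  have h' : ‖dirVec α + dirVec β‖ = √((cos α + cos β) ^ 2 + (sin α + sin β) ^ 2) := by
    simp [dirVec, EuclideanSpace.norm_eq]
  rw [h', h, Real.sqrt_sq_eq_abs, abs_mul, abs_two]

/-- A point moving at unit speed from the origin that touches the lines at distance `1` with unit
normals `u` and `v`, in this order, needs time at least `2 / r`, where `r ≥ max ‖u + v‖ 1`. -/
lemma two_le_mul_of_hits_ordered {E : Type*} [NormedAddCommGroup E] [InnerProductSpace ℝ E]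
    {γ : ℝ → E} (hlip : LipschitzWith 1 γ) (h0 : γ 0 = 0) {u v : E} (hv : ‖v‖ = 1)
    {r s t : ℝ} (hr : 1 ≤ r) (huv : ‖u + v‖ ≤ r) (hs : 0 ≤ s) (hst : s ≤ t)
    (hus : ⟪u, γ s⟫ = 1) (hvt : ⟪v, γ t⟫ = 1) : 2 ≤ r * t := by
  have hγs : ‖γ s‖ ≤ s := by
    have := hlip.dist_le_mul s 0
    simpa [h0, dist_eq_norm, abs_of_nonneg hs] using this
  have hγt : ‖γ t - γ s‖ ≤ t - s := by
    have := hlip.dist_le_mul t s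
    simpa [dist_eq_norm, abs_of_nonneg (sub_nonneg.2 hst)] using this
  have hsum : ⟪u + v, γ s⟫ + ⟪v, γ t - γ s⟫ = 2 := by
    rw [inner_add_left, inner_sub_right]
    linarith
  have h1 : ⟪u + v, γ s⟫ ≤ r * s :=
    (real_inner_le_norm _ _).trans (by gcongr)
  have h2 : ⟪v, γ t - γ s⟫ ≤ t - s :=
    (real_inner_le_norm _ _).trans (by rwa [hv, one_mul])
  nlinarith

lemma two_le_mul_of_hits {E : Type*} [NormedAddCommGroup E] [InnerProductSpace ℝ E]
    {γ : ℝ → E} (hlip : LipschitzWith 1 γ) (h0 : γ 0 = 0) {u v : E} (hu : ‖u‖ = 1) (hv : ‖v‖ = 1)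
    {r c s t : ℝ} (hr : 1 ≤ r) (huv : ‖u + v‖ ≤ r) (hs : s ∈ Set.Icc 0 c) (ht : t ∈ Set.Icc 0 c)
    (hus : ⟪u, γ s⟫ = 1) (hvt : ⟪v, γ t⟫ = 1) : 2 ≤ r * c := by
  rcases le_total s t with hst | hst
  · exact (two_le_mul_of_hits_ordered hlip h0 hv hr huv hs.1 hst hus hvt).trans
      (by gcongr; exact ht.2)
  · exact (two_le_mul_of_hits_ordered hlip h0 hu hr (by rwa [add_comm]) ht.1 hst hvt hus).trans
      (by gcongr; exact hs.2)

lemma abs_cos_pi_mul_div_le {n m : ℕ} (hm : 1 ≤ m) (hmn : m + 1 ≤ n) :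
    |Real.cos (π * m / n)| ≤ Real.cos (π / n) := by
  have hn : (0 : ℝ) < n := by exact_mod_cast (by omega : 0 < n)
  have hm' : (1 : ℝ) ≤ m := by exact_mod_cast hm
  have hmn' : (m : ℝ) + 1 ≤ n := by exact_mod_cast hmn
  have hle : π / n ≤ π * m / n := by
    gcongr
    nlinarith [pi_pos]
  have hle' : π * m / n ≤ π - π / n := by
    rw [div_le_iff₀ hn, sub_mul, div_mul_cancel₀ _ hn.ne']
    nlinarith [pi_pos]
  have hpos : 0 ≤ π / n := by positivity
  rw [abs_le]
  constructor
  · rw [← Real.cos_pi_sub]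
    exact Real.cos_le_cos_of_nonneg_of_le_pi (by linarith) (by linarith) hle'
  · exact Real.cos_le_cos_of_nonneg_of_le_pi hpos (by linarith) hle

/-- Distinct vertices of a regular `n`-gon on the unit circle have a sum of norm at most
`2 * cos (π / n)`. -/
lemma norm_dirVec_add_le {n : ℕ} (α : ℝ) {k l : Fin n} (hkl : k ≠ l) :
    ‖dirVec (α + 2 * π * (k : ℕ) / n) + dirVec (α + 2 * π * (l : ℕ) / n)‖
      ≤ 2 * Real.cos (π / n) := by
  wlog h : l < k generalizing k l
  · rw [add_comm]
    exact this hkl.symm (lt_of_le_of_ne (not_lt.1 h) hkl)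
  have hlk : (l : ℕ) < k := h
  have hk := k.isLt
  rw [norm_dirVec_add]
  have hang : (α + 2 * π * (k : ℕ) / n - (α + 2 * π * (l : ℕ) / n)) / 2
      = π * ((k - l : ℕ) : ℝ) / n := by
    rw [Nat.cast_sub hlk.le]
    ring
  rw [hang]
  gcongr
  exact abs_cos_pi_mul_div_le (by omega) (by omega)

lemma isClosed_setOf_hit {γ : ℝ → EuclideanSpace ℝ (Fin 2)} (hγ : Continuous γ) (c : ℝ) :
    IsClosed {α : ℝ | ∃ t ∈ Set.Icc (0 : ℝ) c, ⟪dirVec α, γ t⟫ = 1} := by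
  have hcont : Continuous fun p : ℝ × Set.Icc (0 : ℝ) c => ⟪dirVec p.1, γ p.2⟫ :=
    (continuous_dirVec.comp continuous_fst).inner
      (hγ.comp (continuous_subtype_val.comp continuous_snd))
  convert isClosedMap_fst_of_compactSpace _ (isClosed_singleton.preimage hcont :
    IsClosed (_ ⁻¹' {(1 : ℝ)})) using 1
  ext α
  simp

/-- A finite family of pairwise disjoint closed sets covering a connected space contains the whole
space. -/
lemma exists_eq_univ_of_isClosed_cover {ι X : Type*} [Finite ι] [TopologicalSpace X]
    [ConnectedSpace X] {A : ι → Set X} (hA : ∀ i, IsClosed (A i)) (hcov : ∀ x, ∃ i, x ∈ A i)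
    (hdisj : ∀ i j x, x ∈ A i → x ∈ A j → i = j) : ∃ i, A i = Set.univ := by
  obtain ⟨x⟩ := (inferInstance : Nonempty X)
  obtain ⟨i, hi⟩ := hcov x
  refine ⟨i, IsClopen.eq_univ ⟨hA i, ?_⟩ ⟨x, hi⟩⟩
  have hcompl : (A i)ᶜ = ⋃ j : {j // j ≠ i}, A j := by
    ext y
    simp only [Set.mem_compl_iff, Set.mem_iUnion]
    constructor
    · intro hy
      obtain ⟨j, hj⟩ := hcov y
      exact ⟨⟨j, fun h => hy (h ▸ hj)⟩, hj⟩
    · rintro ⟨j, hj⟩ hy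
      exact j.2 (hdisj _ _ y hj hy)
  rw [← isClosed_compl_iff, hcompl]
  exact isClosed_iUnion_of_finite fun j => hA j

theorem shoreline_lower_bound_ge_four
    (n : ℕ) (hn : 4 ≤ n)
    (γ : Fin n → ℝ → EuclideanSpace ℝ (Fin 2))
    (hlip : ∀ i, LipschitzWith 1 (γ i)) (h0 : ∀ i, γ i 0 = 0) :
    ∀ c : ℝ, 0 ≤ c → c < 1 / Real.cos (π / n) →
      ∃ u : EuclideanSpace ℝ (Fin 2), ∃ ρ : ℝ, ‖u‖ = 1 ∧ 0 < ρ ∧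
        ∀ i, ∀ t ∈ Set.Icc (0 : ℝ) (c * ρ), ⟪u, γ i t⟫ ≠ ρ := by
  intro c _ hc
  by_contra! hcon
  have hnpos : (0 : ℝ) < n := by exact_mod_cast (by omega : 0 < n)
  have hhalf : 1 ≤ 2 * Real.cos (π / n) := by
    have : Real.cos (π / 3) ≤ Real.cos (π / n) := by
      apply Real.cos_le_cos_of_nonneg_of_le_pi (by positivity) (by linarith [pi_pos])
      gcongr
      exact_mod_cast (by omega : 3 ≤ n)
    rw [Real.cos_pi_div_three] at this
    linarith
  have hlt : 2 * Real.cos (π / n) * c < 2 := by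
    rw [lt_div_iff₀ (by linarith)] at hc
    linarith
  set A : Fin n → Set ℝ := fun i => {α | ∃ t ∈ Set.Icc (0 : ℝ) c, ⟪dirVec α, γ i t⟫ = 1}
  have hcov : ∀ α, ∃ i, α ∈ A i := fun α => by
    obtain ⟨i, t, ht, h⟩ := hcon (dirVec α) 1 (norm_dirVec α) one_pos
    exact ⟨i, t, by simpa using ht, h⟩
  have huniq : ∀ i α (k l : Fin n), α + 2 * π * (k : ℕ) / n ∈ A i →
      α + 2 * π * (l : ℕ) / n ∈ A i → k = l := by
    rintro i α k l ⟨s, hs, hus⟩ ⟨t, ht, hvt⟩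
    by_contra hkl
    exact hlt.not_ge (two_le_mul_of_hits (hlip i) (h0 i) (norm_dirVec _) (norm_dirVec _) hhalf
      (norm_dirVec_add_le α hkl) hs ht hus hvt)
  have hdisj : ∀ i j α, α ∈ A i → α ∈ A j → i = j := by
    intro i j α hi hj
    choose f hf using fun k : Fin n => hcov (α + 2 * π * (k : ℕ) / n)
    have hinj : Function.Injective f := fun k l hkl => huniq (f k) α k l (hf k) (hkl ▸ hf l)
    have hsurj := Finite.surjective_of_injective hinj
    have hzero : ∀ m, α ∈ A m → m = f ⟨0, by omega⟩ := fun m hm => by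
      obtain ⟨k, rfl⟩ := hsurj m
      rw [huniq (f k) α k ⟨0, by omega⟩ (hf k) (by simpa using hm)]
    rw [hzero i hi, hzero j hj]
  obtain ⟨i, hi⟩ := exists_eq_univ_of_isClosed_cover
    (fun i => isClosed_setOf_hit (hlip i).continuous c) hcov hdisj
  have := huniq i 0 ⟨0, by omega⟩ ⟨1, by omega⟩ (hi ▸ Set.mem_univ _) (hi ▸ Set.mem_univ _)
  simp at this
end

section
/- Let C = {p ∈ ℝ² : p₁ ≥ ‖p‖/2} be the closed cone with apex at the origin O, axis the positive x-axis, and half-angle π/3 (so the cone has angle 2π/3), and let ℓ = {p ∈ ℝ² : p₁ = 1/2} be the line through the two points A = (1/2, √3/2) and B = (1/2, −√3/2) lying on the extreme rays of C at distance 1 from O. Let γ : ℝ → ℝ² be a 1-Lipschitz function with γ(0) = 0. If there exist times 0 ≤ t₁ ≤ t₂ such that (γ(t₁))₁ = 1/2 (γ visits the line ℓ) and γ(t₂) ∉ C (γ has left the cone), then t₂ ≥ √3/2. In words, a unit-speed robot starting from O requires time at least √3/2 to visit the line through A and B and then leave the cone. -/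
open Real

/-- Points outside the closed cone of half-angle `π / 3` around the positive first axis are at
distance at least `√3 / 2` from `(1, 0)`. -/
theorem sqrt_three_div_two_le_dist_of_notMem_cone (q : EuclideanSpace ℝ (Fin 2))
    (hq : ¬ q 0 ≥ ‖q‖ / 2) : √3 / 2 ≤ dist !₂[(1 : ℝ), 0] q := by
  have hn : ‖q‖ ^ 2 = q 0 ^ 2 + q 1 ^ 2 := by
    simp [EuclideanSpace.norm_sq_eq, Fin.sum_univ_two]
  have hd : dist !₂[(1 : ℝ), 0] q ^ 2 = (1 - q 0) ^ 2 + q 1 ^ 2 := by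
    simp [EuclideanSpace.dist_sq_eq, Fin.sum_univ_two, Real.dist_eq, sq_abs]
  have h3 : (√3 / 2) ^ 2 = 3 / 4 := by
    rw [div_pow, Real.sq_sqrt (by norm_num)]
    norm_num
  refine (abs_le_of_sq_le_sq' ?_ dist_nonneg).2
  rw [h3, hd]
  rw [ge_iff_le, not_le] at hq
  rcases le_or_gt (q 0) 0 with h | h
  · nlinarith [sq_nonneg (q 0), sq_nonneg (q 1)]
  · nlinarith [sq_nonneg (2 * q 0 - 1 / 2)]

/-- Points on the line `p₁ = 1 / 2` are equidistant from the origin and `(1, 0)`. -/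
theorem dist_one_zero_eq_dist_zero (p : EuclideanSpace ℝ (Fin 2)) (hp : p 0 = 1 / 2) :
    dist !₂[(1 : ℝ), 0] p = dist 0 p := by
  rw [EuclideanSpace.dist_eq, EuclideanSpace.dist_eq]
  norm_num [Fin.sum_univ_two, Real.dist_eq, hp]

theorem visit_line_and_leave_cone_time
    (γ : ℝ → EuclideanSpace ℝ (Fin 2))
    (hlip : LipschitzWith 1 γ) (h0 : γ 0 = 0)
    (t₁ t₂ : ℝ) (ht₁ : 0 ≤ t₁) (ht : t₁ ≤ t₂)
    (hhit : (γ t₁) 0 = 1 / 2)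
    (hout : ¬ (γ t₂) 0 ≥ ‖γ t₂‖ / 2) :
    t₂ ≥ Real.sqrt 3 / 2 := by
  have h1 : dist (γ 0) (γ t₁) ≤ t₁ := by
    simpa [Real.dist_eq, abs_of_nonneg ht₁] using hlip.dist_le_mul 0 t₁
  have h2 : dist (γ t₁) (γ t₂) ≤ t₂ - t₁ := by
    simpa [dist_comm t₁ t₂, Real.dist_eq, abs_of_nonneg (sub_nonneg.2 ht)] using
      hlip.dist_le_mul t₁ t₂
  have h3 := sqrt_three_div_two_le_dist_of_notMem_cone _ hout
  have h4 := dist_one_zero_eq_dist_zero _ hhit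
  have h5 := dist_triangle !₂[(1 : ℝ), 0] (γ t₁) (γ t₂)
  rw [h0] at h1
  linarith
end

section
/- For every real λ ∈ [0, 1], (1/2)·√(3λ² + 1) + (√3/4)·(1 − λ) ≥ √3/2, and equality holds if and only if λ = 1/3. -/
open Real

theorem key_minimization (lam : ℝ) (hlam : lam ∈ Set.Icc (0 : ℝ) 1) :
    (1 / 2) * Real.sqrt (3 * lam ^ 2 + 1) + (Real.sqrt 3 / 4) * (1 - lam) ≥ Real.sqrt 3 / 2 ∧
    ((1 / 2) * Real.sqrt (3 * lam ^ 2 + 1) + (Real.sqrt 3 / 4) * (1 - lam) = Real.sqrt 3 / 2 ↔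
      lam = 1 / 3) := by
  obtain ⟨h0, -⟩ := hlam
  have hs : √3 ^ 2 = 3 := Real.sq_sqrt (by norm_num)
  have ht : √(3 * lam ^ 2 + 1) ^ 2 = 3 * lam ^ 2 + 1 := Real.sq_sqrt (by positivity)
  have hgap : √(3 * lam ^ 2 + 1) ^ 2 - (√3 / 2 * (1 + lam)) ^ 2 = (3 * lam - 1) ^ 2 / 4 := by
    linear_combination ht - (1 + lam) ^ 2 / 4 * hs
  have hle : √3 / 2 * (1 + lam) ≤ √(3 * lam ^ 2 + 1) :=
    abs_le_of_sq_le_sq' (by nlinarith [sq_nonneg (3 * lam - 1)]) (Real.sqrt_nonneg _) |>.2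
  refine ⟨by linarith, fun h => ?_, fun h => ?_⟩
  · have heq : √(3 * lam ^ 2 + 1) = √3 / 2 * (1 + lam) := by linarith
    rw [heq, sub_self] at hgap
    have : 3 * lam - 1 = 0 := pow_eq_zero_iff two_ne_zero |>.mp (by linarith)
    linarith
  · have heq : √(3 * lam ^ 2 + 1) = √3 / 2 * (1 + lam) := by
      refine (sq_eq_sq₀ (Real.sqrt_nonneg _) (by positivity)).mp (sub_eq_zero.mp ?_)
      rw [hgap, h]
      norm_num
    linarith
end

section
/- Let γ₁, γ₂, γ₃ : ℝ → ℝ² be 1-Lipschitz functions with γᵢ(0) = 0 for i = 1, 2, 3 (three unit-speed robots searching the plane for a shoreline). Then for every c with 0 ≤ c < √3 there exist a unit vector u ∈ ℝ² and ρ > 0 such that for every i ∈ {1, 2, 3} and every t ∈ [0, c·ρ], ⟪u, γᵢ(t)⟫ ≠ ρ. That is, some line at positive distance ρ from the origin is not hit by any robot within time c·ρ; hence the best possible search competitive ratio for shoreline search with 3 robots satisfies 𝒮₃ ≥ √3. -/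
open Real
open scoped RealInnerProductSpace

/-- A `1`-Lipschitz trajectory from the origin which visits the line `⟪u, ·⟫ = 1` and later the
line `⟪v, ·⟫ = 1` needs time at least the distance of the second line from the mirror image `2 • u`
of the origin in the first one. -/
lemma one_sub_two_mul_inner_le_of_visits {E : Type*} [NormedAddCommGroup E]
    [InnerProductSpace ℝ E] {g : ℝ → E} (hg : LipschitzWith 1 g) (hg0 : g 0 = 0) {u v : E}
    (hu : ‖u‖ = 1) (hv : ‖v‖ = 1) {s t : ℝ} (hs : 0 ≤ s) (hst : s ≤ t)
    (hus : ⟪u, g s⟫ = 1) (hvt : ⟪v, g t⟫ = 1) : 1 - 2 * ⟪u, v⟫ ≤ t := by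
  have hgs : ‖g s‖ ≤ s := by
    simpa [hg0, dist_eq_norm, abs_of_nonneg hs] using hg.dist_le_mul s 0
  have hgt : ‖g t - g s‖ ≤ t - s := by
    simpa [dist_eq_norm, abs_of_nonneg (sub_nonneg.2 hst)] using hg.dist_le_mul t s
  have hmirror : ‖g s - (2 : ℝ) • u‖ = ‖g s‖ := by
    rw [← sq_eq_sq₀ (norm_nonneg _) (norm_nonneg _), norm_sub_sq_real, inner_smul_right,
      real_inner_comm, hus, norm_smul, hu]
    norm_num
  have h₁ := real_inner_le_norm v (g t - g s)
  have h₂ := real_inner_le_norm v (g s - (2 : ℝ) • u)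
  rw [inner_sub_right, hvt, hv] at h₁
  rw [inner_sub_right, inner_smul_right, real_inner_comm, hv, hmirror, real_inner_comm u v] at h₂
  rw [real_inner_comm v (g s)] at h₂
  linarith

/-- The unit vector of the plane at angle `θ`. -/
noncomputable def planeUnit (θ : ℝ) : EuclideanSpace ℝ (Fin 2) := !₂[cos θ, sin θ]

lemma norm_planeUnit (θ : ℝ) : ‖planeUnit θ‖ = 1 := by
  simp [planeUnit, EuclideanSpace.norm_eq]

lemma inner_planeUnit (θ φ : ℝ) : ⟪planeUnit θ, planeUnit φ⟫ = cos (φ - θ) := by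
  simp [planeUnit, PiLp.inner_apply, Fin.sum_univ_two, cos_sub]

lemma cos_five_pi_div_eight_le : cos (5 * π / 8) ≤ -3 / 8 := by
  have h : cos (5 * π / 8) = -sin (π / 8) := by
    rw [← cos_add_pi_div_two]; ring_nf
  rw [h, sin_pi_div_eight]
  have h₂ : √2 ≤ 23 / 16 := by rw [sqrt_le_left (by norm_num)]; norm_num
  have : 3 / 4 ≤ √(2 - √2) := le_sqrt_of_sq_le (by linarith)
  linarith

lemma cos_five_pi_div_four_le : cos (5 * π / 4) ≤ -3 / 8 := by
  have h : cos (5 * π / 4) = -cos (π / 4) := by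
    rw [← cos_add_pi]; ring_nf
  rw [h, cos_pi_div_four]
  have : 3 / 4 ≤ √2 := le_sqrt_of_sq_le (by norm_num)
  linarith

lemma cos_seventy_five_pi_div_eight_le : cos (75 * π / 8) ≤ -3 / 8 := by
  have h : cos (75 * π / 8) = cos (5 * π / 8) := by
    rw [← cos_neg (5 * π / 8), ← cos_add_nat_mul_two_pi (-(5 * π / 8)) 5]
    congr 1; push_cast; ring
  rw [h]; exact cos_five_pi_div_eight_le

/-- A colouring of `ℕ` with three colours in which any three consecutive numbers have different
colours is `3`-periodic. -/
lemma apply_add_three_eq {f : ℕ → Fin 3} (h₁ : ∀ k, f k ≠ f (k + 1))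
    (h₂ : ∀ k, f k ≠ f (k + 2)) (k : ℕ) : f (k + 3) = f k := by
  have a := h₁ k
  have b := h₁ (k + 1)
  have c := h₁ (k + 2)
  have d := h₂ k
  have e := h₂ (k + 1)
  simp only [add_assoc, Nat.reduceAdd] at b c e
  omega

theorem shoreline_lower_bound_three
    (γ : Fin 3 → ℝ → EuclideanSpace ℝ (Fin 2))
    (hlip : ∀ i, LipschitzWith 1 (γ i)) (h0 : ∀ i, γ i 0 = 0) :
    ∀ c : ℝ, 0 ≤ c → c < Real.sqrt 3 →
      ∃ u : EuclideanSpace ℝ (Fin 2), ∃ ρ : ℝ, ‖u‖ = 1 ∧ 0 < ρ ∧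
        ∀ i, ∀ t ∈ Set.Icc (0 : ℝ) (c * ρ), ⟪u, γ i t⟫ ≠ ρ := by
  intro c _ hc
  by_contra! hcon
  have hc' : c < 7 / 4 := hc.trans (by rw [sqrt_lt' (by norm_num)]; norm_num)
  have hhit : ∀ k : ℕ, ∃ i, ∃ t ∈ Set.Icc (0 : ℝ) c,
      ⟪planeUnit (k * (5 * π / 8)), γ i t⟫ = 1 := fun k ↦ by
    simpa using hcon (planeUnit (k * (5 * π / 8))) 1 (norm_planeUnit _) one_pos
  choose f τ hτ hfτ using hhit
  have hne : ∀ k l : ℕ, cos (l * (5 * π / 8) - k * (5 * π / 8)) ≤ -3 / 8 → f k ≠ f l := by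
    intro k l hkl heq
    have hk := hfτ k
    rw [heq] at hk
    rcases le_total (τ k) (τ l) with h | h
    · have := one_sub_two_mul_inner_le_of_visits (hlip _) (h0 _) (norm_planeUnit _)
        (norm_planeUnit _) (hτ k).1 h hk (hfτ l)
      rw [inner_planeUnit] at this
      linarith [(hτ l).2]
    · have := one_sub_two_mul_inner_le_of_visits (hlip _) (h0 _) (norm_planeUnit _)
        (norm_planeUnit _) (hτ l).1 h (hfτ l) hk
      rw [real_inner_comm, inner_planeUnit] at this
      linarith [(hτ k).2]
  have h₁ : ∀ k, f k ≠ f (k + 1) := fun k ↦ hne _ _ <| by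
    convert cos_five_pi_div_eight_le using 2; push_cast; ring
  have h₂ : ∀ k, f k ≠ f (k + 2) := fun k ↦ hne _ _ <| by
    convert cos_five_pi_div_four_le using 2; push_cast; ring
  have h₁₅ : f 0 ≠ f 15 := hne _ _ <| by
    convert cos_seventy_five_pi_div_eight_le using 2; push_cast; ring
  have hper := apply_add_three_eq h₁ h₂
  exact h₁₅ ((hper 0).symm.trans <| (hper 3).symm.trans <| (hper 6).symm.trans <|
    (hper 9).symm.trans (hper 12).symm)
end

section
/- Let γ₁, γ₂ : ℝ → ℝ² be 1-Lipschitz functions with γ₁(0) = γ₂(0) = 0 (two unit-speed robots searching the plane for a shoreline). Then for every c with 0 ≤ c < 3 there exist a unit vector u ∈ ℝ² and ρ > 0 such that for every i ∈ {1, 2} and every t ∈ [0, c·ρ], ⟪u, γᵢ(t)⟫ ≠ ρ. That is, some line at positive distance ρ from the origin is not hit by either robot within time c·ρ; hence the best possible search competitive ratio for shoreline search with 2 robots satisfies 𝒮₂ ≥ 3. -/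
open Real
open scoped RealInnerProductSpace

section

variable {E : Type*} [NormedAddCommGroup E] [InnerProductSpace ℝ E]

lemma inner_sub_le_abs_sub_of_lipschitzWith {γ : ℝ → E} (hγ : LipschitzWith 1 γ) {u : E}
    (hu : ‖u‖ = 1) (s t : ℝ) : ⟪u, γ s⟫ - ⟪u, γ t⟫ ≤ |s - t| := by
  have h := hγ.dist_le_mul s t
  rw [dist_eq_norm, Real.dist_eq, NNReal.coe_one, one_mul] at h
  calc ⟪u, γ s⟫ - ⟪u, γ t⟫ = ⟪u, γ s - γ t⟫ := (inner_sub_right _ _ _).symm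
    _ ≤ ‖u‖ * ‖γ s - γ t‖ := real_inner_le_norm _ _
    _ ≤ |s - t| := by rwa [hu, one_mul]

/-- A unit-speed path from the origin meeting two opposite tangent lines of the unit circle
needs time at least `3`. -/
lemma three_le_max_of_inner_eq_one {γ : ℝ → E} (hγ : LipschitzWith 1 γ) (h0 : γ 0 = 0) {u : E}
    (hu : ‖u‖ = 1) {s t : ℝ} (hs : 0 ≤ s) (ht : 0 ≤ t) (hus : ⟪u, γ s⟫ = 1)
    (hut : ⟪-u, γ t⟫ = 1) : 3 ≤ max s t := by
  rw [inner_neg_left] at hut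
  have h1 := inner_sub_le_abs_sub_of_lipschitzWith hγ hu s 0
  have h2 := inner_sub_le_abs_sub_of_lipschitzWith hγ hu 0 t
  have h3 := inner_sub_le_abs_sub_of_lipschitzWith hγ hu s t
  rw [h0, inner_zero_right, sub_zero, sub_zero, abs_of_nonneg hs] at h1
  rw [h0, inner_zero_right, zero_sub, zero_sub, abs_neg, abs_of_nonneg ht] at h2
  rcases abs_cases (s - t) with h | h <;> rw [le_max_iff]
  · left; linarith
  · right; linarith

lemma isClosed_setOf_exists_inner_eq {γ : ℝ → E} (hγ : Continuous γ) (c ρ : ℝ) :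
    IsClosed {u : E | ∃ t ∈ Set.Icc 0 c, ⟪u, γ t⟫ = ρ} := by
  have h : IsClosed {p : E × Set.Icc 0 c | ⟪p.1, γ p.2⟫ = ρ} :=
    isClosed_eq (by fun_prop) continuous_const
  convert isClosedMap_fst_of_compactSpace _ h using 1
  ext u
  simp

/-- In dimension greater than `1`, if two closed sets cover the unit sphere then one of them
contains a pair of antipodal points. -/
lemma exists_antipodal_mem_of_sphere_subset_union (hE : 1 < Module.rank ℝ E) {A B : Set E}
    (hA : IsClosed A) (hB : IsClosed B) (h : Metric.sphere 0 1 ⊆ A ∪ B) :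
    ∃ u : E, ‖u‖ = 1 ∧ (u ∈ A ∧ -u ∈ A ∨ u ∈ B ∧ -u ∈ B) := by
  by_contra! H
  have hcov (u : E) (hu : ‖u‖ = 1) : u ∈ A ∨ u ∈ B := h (by simpa using hu)
  have hconn := isConnected_sphere hE (0 : E) zero_le_one
  obtain ⟨v, hv⟩ := hconn.nonempty
  have key (u : E) (hu : ‖u‖ = 1) :
      (u ∈ A → -u ∉ A) ∧ (u ∈ B → -u ∉ B) ∧ (-u ∈ A ∨ -u ∈ B) :=
    ⟨(H u hu).1, (H u hu).2, hcov _ (by rwa [norm_neg])⟩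
  have hv1 : ‖v‖ = 1 := by simpa using hv
  have hnv : -v ∈ Metric.sphere (0 : E) 1 := by simpa using hv1
  have hne : (Metric.sphere 0 1 ∩ A).Nonempty ∧ (Metric.sphere 0 1 ∩ B).Nonempty := by
    have := key v hv1
    rcases hcov v hv1 with hvA | hvB
    · exact ⟨⟨v, hv, hvA⟩, ⟨-v, hnv, by tauto⟩⟩
    · exact ⟨⟨-v, hnv, by tauto⟩, ⟨v, hv, hvB⟩⟩
  obtain ⟨u, hu, huA, huB⟩ :=
    isPreconnected_closed_iff.1 hconn.isPreconnected A B hA hB h hne.1 hne.2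
  have := key u (by simpa using hu)
  tauto

end

theorem shoreline_lower_bound_two
    (γ : Fin 2 → ℝ → EuclideanSpace ℝ (Fin 2))
    (hlip : ∀ i, LipschitzWith 1 (γ i)) (h0 : ∀ i, γ i 0 = 0) :
    ∀ c : ℝ, 0 ≤ c → c < 3 →
      ∃ u : EuclideanSpace ℝ (Fin 2), ∃ ρ : ℝ, ‖u‖ = 1 ∧ 0 < ρ ∧
        ∀ i, ∀ t ∈ Set.Icc (0 : ℝ) (c * ρ), ⟪u, γ i t⟫ ≠ ρ := by
  intro c _ hc
  by_contra! H
  let A (i : Fin 2) : Set (EuclideanSpace ℝ (Fin 2)) :=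
    {u | ∃ t ∈ Set.Icc 0 c, ⟪u, γ i t⟫ = 1}
  have hA (i : Fin 2) : IsClosed (A i) := isClosed_setOf_exists_inner_eq (hlip i).continuous c 1
  have hcov : Metric.sphere 0 1 ⊆ A 0 ∪ A 1 := by
    intro u hu
    obtain ⟨i, t, ht, h⟩ := H u 1 (by simpa using hu) one_pos
    rw [mul_one] at ht
    fin_cases i
    · exact Or.inl ⟨t, ht, h⟩
    · exact Or.inr ⟨t, ht, h⟩
  have hnot (i : Fin 2) (u : EuclideanSpace ℝ (Fin 2)) (hu : ‖u‖ = 1) :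
      ¬ (u ∈ A i ∧ -u ∈ A i) := by
    rintro ⟨⟨s, hs, hus⟩, ⟨t, ht, hut⟩⟩
    have := three_le_max_of_inner_eq_one (hlip i) (h0 i) hu hs.1 ht.1 hus hut
    exact absurd (this.trans (max_le hs.2 ht.2)) hc.not_ge
  have hrank : 1 < Module.rank ℝ (EuclideanSpace ℝ (Fin 2)) := by
    rw [← Module.finrank_eq_rank, finrank_euclideanSpace_fin]
    norm_num
  obtain ⟨u, hu, h | h⟩ := exists_antipodal_mem_of_sphere_subset_union hrank (hA 0) (hA 1) hcov
  · exact hnot 0 u hu h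
  · exact hnot 1 u hu h
end
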